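/- Let F be a field, n ≥ 1, and X ∈ M_n(F). The following are equivalent: (i) there exists a row vector v ∈ F^n such that v, vX, …, vX^{n−1} form a basis of F^n; (ii) the centralizer {Y ∈ M_n(F) : XY = YX} is an n-dimensional F-vector space; (iii) the minimal polynomial of X equals the characteristic polynomial of X. -/

import Mathlib

/-- If the endomorphism algebra of a product is no larger than the product, then there are no
nonzero off-diagonal maps. -/
lemma offdiag_zero {F R : Type*} [Field F] [CommRing R] [Algebra F R] {ι : Type*}
    [DecidableEq ι] (A : ι → Type*) [∀ i, CommRing (A i)] [∀ i, Algebra F (A i)]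
    [∀ i, Algebra R (A i)] [∀ i, IsScalarTower F R (A i)]
    [Module.Finite F (Π i, A i)]
    (h : Module.finrank F (Module.End R (Π i, A i)) ≤ Module.finrank F (Π i, A i))
    (i j : ι) (hij : i ≠ j) (u : A i →ₗ[R] A j) : u 1 = 0 := by
  have hfe : Module.Finite F (Module.End R (Π i, A i)) :=
    Module.Finite.of_injective (LinearMap.restrictScalarsₗ F R (Π i, A i) (Π i, A i) F)
      (LinearMap.restrictScalars_injective F)
  let D : (Π i, A i) →ₗ[F] Module.End R (Π i, A i) :=
    (Algebra.lmul R (Π i, A i)).toLinearMap.restrictScalars F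
  have hD : Function.Injective D := fun a b hab => by
    have := LinearMap.congr_fun hab 1
    simpa [D] using this
  have hs : Function.Surjective D :=
    (LinearMap.injective_iff_surjective_of_finrank_eq_finrank (f := D)
      (le_antisymm (LinearMap.finrank_le_finrank_of_injective hD) h)).1 hD
  obtain ⟨d, hd⟩ := hs ((LinearMap.single R A j) ∘ₗ u ∘ₗ LinearMap.proj i)
  have h2 := congr_fun (LinearMap.congr_fun hd (Pi.single i 1)) j
  simpa [D, hij, Pi.single_eq_of_ne hij.symm] using h2.symm

lemma coprime_of_hom {R : Type*} [EuclideanDomain R] [DecidableEq R] (p q : R) (hq : q ≠ 0)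
    (h : ∀ u : (R ⧸ Ideal.span {p}) →ₗ[R] (R ⧸ Ideal.span {q}), u 1 = 0) : IsCoprime p q := by
  obtain ⟨a, ha⟩ := EuclideanDomain.gcd_dvd_left p q
  obtain ⟨b, hb⟩ := EuclideanDomain.gcd_dvd_right p q
  generalize hg : EuclideanDomain.gcd p q = g at ha hb
  have h3 := h (Submodule.liftQ _
    (LinearMap.toSpanSingleton R _ (Ideal.Quotient.mk (Ideal.span {q}) b)) (by
      rw [Ideal.span, Submodule.span_le, Set.singleton_subset_iff, SetLike.mem_coe,
        LinearMap.mem_ker, LinearMap.toSpanSingleton_apply, Algebra.smul_def,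
        Ideal.Quotient.algebraMap_eq, ← map_mul,
        Ideal.Quotient.eq_zero_iff_mem, Ideal.mem_span_singleton]
      exact ⟨a, by rw [ha, hb]; ring⟩))
  have h4 : (1 : R) • Ideal.Quotient.mk (Ideal.span {q}) b = 0 := h3
  rw [one_smul, Ideal.Quotient.eq_zero_iff_mem, Ideal.mem_span_singleton] at h4
  obtain ⟨c, hc⟩ := h4
  have hb0 : b ≠ 0 := by rintro rfl; exact hq (by rw [hb, mul_zero])
  have : g * c = 1 := by
    apply mul_right_cancel₀ hb0
    rw [one_mul]; nth_rw 2 [hc]; rw [hb]; ring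
  exact EuclideanDomain.gcd_isUnit_iff.1 (hg ▸ IsUnit.of_mul_eq_one _ this)

open Polynomial in
lemma finrank_pi_quot {F : Type*} [Field F] {ι : Type*} [Fintype ι] (q : ι → F[X])
    (hq : ∀ i, q i ≠ 0) [Module.Finite F (Π i, F[X] ⧸ Ideal.span {q i})] :
    Module.finrank F (Π i, F[X] ⧸ Ideal.span {q i}) = (∏ i, q i).natDegree := by
  have hfi : ∀ i, Module.Finite F (F[X] ⧸ Ideal.span {q i}) := fun i =>
    Module.Finite.of_surjective (LinearMap.proj i : (Π i, F[X] ⧸ Ideal.span {q i}) →ₗ[F] _)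
      (Function.surjective_eval i)
  rw [Module.finrank_pi_fintype, natDegree_prod _ _ (fun i _ => hq i)]
  exact Finset.sum_congr rfl fun i _ => finrank_quotient_span_eq_natDegree

open Polynomial in
lemma finrank_le_of_equiv {F : Type*} [Field F] {M : Type*} [AddCommGroup M] [Module F[X] M]
    [Module F M] [IsScalarTower F F[X] M] [Module.Finite F M]
    {ι : Type*} [Fintype ι] (q : ι → F[X]) (hq : ∀ i, q i ≠ 0)
    (f : M ≃ₗ[F[X]] (Π i, F[X] ⧸ Ideal.span {q i}))
    (h : Module.finrank F (Module.End F[X] M) ≤ Module.finrank F M) (p : F[X]) (hp0 : p ≠ 0)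
    (hp : ∀ m : M, p • m = 0) : Module.finrank F M ≤ p.natDegree := by
  classical
  have e1 := (f.restrictScalars F).finrank_eq
  have hfin : Module.Finite F (Π i, F[X] ⧸ Ideal.span {q i}) :=
    Module.Finite.equiv (f.restrictScalars F)
  have e2 := (f.conj.restrictScalars F).finrank_eq
  have hc : ∀ i j, i ≠ j → IsCoprime (q i) (q j) := fun i j hij =>
    coprime_of_hom _ _ (hq j) (offdiag_zero (F := F) (R := F[X])
      (fun i => F[X] ⧸ Ideal.span {q i}) (by rw [← e1, ← e2]; exact h) i j hij)
  have hd : ∀ i, q i ∣ p := fun i => by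
    have := congr_fun (map_smul f p (f.symm 1)) i
    rw [hp, LinearEquiv.apply_symm_apply, map_zero] at this
    have h1 : (0 : F[X] ⧸ Ideal.span {q i}) = Ideal.Quotient.mk (Ideal.span {q i}) (p * 1) := this
    rw [mul_one] at h1
    rw [← Ideal.mem_span_singleton, ← Ideal.Quotient.eq_zero_iff_mem]
    exact h1.symm
  have hQ := Finset.prod_dvd_of_coprime (s := q) (t := Finset.univ) (z := p)
    (fun i _ j _ hij => hc i j hij) (fun i _ => hd i)
  rw [e1, finrank_pi_quot q hq]
  exact natDegree_le_of_dvd hQ hp0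

open Polynomial in
lemma finrank_le_of_end {F : Type*} [Field F] {M : Type*} [AddCommGroup M] [Module F[X] M]
    [Module F M] [IsScalarTower F F[X] M]
    [Module.Finite F M] (ht : Module.IsTorsion F[X] M)
    (h : Module.finrank F (Module.End F[X] M) ≤ Module.finrank F M) (p : F[X]) (hp0 : p ≠ 0)
    (hp : ∀ m : M, p • m = 0) : Module.finrank F M ≤ p.natDegree := by
  have : Module.Finite F[X] M := Module.Finite.of_restrictScalars_finite F _ _
  obtain ⟨ι, _, p', hp', e, ⟨f⟩⟩ := Module.equiv_directSum_of_isTorsion ht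
  exact finrank_le_of_equiv (fun i => p' i ^ e i) (fun i => pow_ne_zero _ (hp' i).ne_zero)
    (f.trans (DirectSum.linearEquivFunOnFintype F[X] ι _)) h p hp0 hp

open Polynomial in
lemma aeval_vecMulLinear {F : Type*} [Field F] {n : ℕ} (X : Matrix (Fin n) (Fin n) F) (p : F[X])
    (v : Fin n → F) :
    aeval (R := F) (A := Module.End F (Fin n → F)) X.vecMulLinear p v =
      Matrix.vecMul v (aeval X p) := by
  induction p using Polynomial.induction_on' with
  | add p q hp hq => simp [hp, hq, Matrix.vecMul_add]
  | monomial k a =>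
    have : ∀ v, ((X.vecMulLinear : Module.End F (Fin n → F)) ^ k) v = Matrix.vecMul v (X ^ k) := by
      induction k with
      | zero => simp
      | succ k ih => intro v; rw [pow_succ, Module.End.mul_apply, ih, pow_succ']; simp
    rw [aeval_monomial, aeval_monomial, ← Algebra.smul_def, ← Algebra.smul_def,
      LinearMap.smul_apply, this, Matrix.vecMul_smul]

open Polynomial in
lemma cyclic_of_minpoly {F : Type*} [Field F] {n : ℕ} (X : Matrix (Fin n) (Fin n) F)
    (h : minpoly F X = X.charpoly) : ∃ v : Fin n → F,
        LinearIndependent F (fun i : Fin n => Matrix.vecMul v (X ^ (i : ℕ))) := by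
  have hd : n = (minpoly F X).natDegree := by rw [h, Matrix.charpoly_natDegree_eq_dim]; simp
  let φ : Module.End F (Fin n → F) := X.vecMulLinear
  obtain ⟨x, hx⟩ := Module.exists_ker_toSpanSingleton_eq_annihilator F[X] (Module.AEval' φ)
  refine ⟨(Module.AEval'.of φ).symm x, ?_⟩
  rw [Fintype.linearIndependent_iff]
  intro g hg
  let p : F[X] := ∑ i : Fin n, C (g i) * Polynomial.X ^ (i : ℕ)
  have hpX : aeval X p = ∑ i : Fin n, g i • X ^ (i : ℕ) := by
    simp [p, ← Algebra.smul_def]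
  have hp : p ∈ Module.annihilator F[X] (Module.AEval' φ) := by
    rw [← hx, LinearMap.mem_ker, LinearMap.toSpanSingleton_apply]
    apply (Module.AEval'.of φ).symm.injective
    rw [map_zero]
    refine (aeval_vecMulLinear X p ((Module.AEval'.of φ).symm x)).trans ?_
    refine Eq.trans ?_ hg
    generalize (Module.AEval'.of φ).symm x = v
    rw [hpX, Matrix.vecMul_sum]
    simp [Matrix.vecMul_smul]
  have h0 : aeval X p = 0 := by
    apply Matrix.ext_of_single_vecMul
    intro i
    have := Module.mem_annihilator.1 hp (Module.AEval'.of φ (Pi.single i 1))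
    rw [Matrix.vecMul_zero]
    exact (aeval_vecMulLinear X p _).symm.trans this
  have hl := (linearIndependent_pow (K := F) X).comp (Fin.cast hd) (Fin.cast_injective hd)
  exact Fintype.linearIndependent_iff.1 hl g (by rw [← h0, hpX]; rfl)

open Polynomial in
lemma natDegree_of_finrank {F : Type*} [Field F] {n : ℕ} (X : Matrix (Fin n) (Fin n) F)
    (h : Module.finrank F (Subalgebra.centralizer F ({X} : Set (Matrix (Fin n) (Fin n) F))) = n) :
    n ≤ (minpoly F X).natDegree := by
  let φ : Module.End F (Fin n → F) := Matrix.toLinAlgEquiv' X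
  let M := Module.AEval' φ
  have hM : Module.finrank F M = n := by
    rw [← (Module.AEval'.of φ).finrank_eq]; simp
  have ht : Module.IsTorsion F[X] M := Module.AEval.isTorsion_of_finiteDimensional F _ φ
  let Ψ₀ : Module.End F[X] M →ₗ[F] Matrix (Fin n) (Fin n) F :=
    Matrix.toLinAlgEquiv'.symm.toLinearMap ∘ₗ
      (Module.AEval'.of φ).symm.conj.toLinearMap ∘ₗ LinearMap.restrictScalarsₗ F F[X] M M F
  have hΨ : Function.Injective Ψ₀ :=
    Matrix.toLinAlgEquiv'.symm.injective.comp
      ((Module.AEval'.of φ).symm.conj.injective.comp (LinearMap.restrictScalars_injective F))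
  have hmem : ∀ f, Ψ₀ f ∈ Subalgebra.toSubmodule
      (Subalgebra.centralizer F ({X} : Set (Matrix (Fin n) (Fin n) F))) := by
    intro f
    rw [Subalgebra.mem_toSubmodule, Subalgebra.mem_centralizer_iff]
    rintro _ rfl
    apply Matrix.toLinAlgEquiv'.injective
    rw [map_mul, map_mul]
    have : Matrix.toLinAlgEquiv' (Ψ₀ f) =
      (Module.AEval'.of φ).symm.conj (f.restrictScalars F) :=
        Matrix.toLinAlgEquiv'.apply_symm_apply _
    rw [this]
    refine LinearMap.ext fun v => ?_
    have h1 := map_smul f (Polynomial.X : F[X]) (Module.AEval'.of φ v)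
    rw [Module.AEval'.X_smul_of] at h1
    have h2 := congrArg (Module.AEval'.of φ).symm h1
    rw [Module.AEval'.of_symm_X_smul] at h2
    exact h2.symm
  have hle : Module.finrank F (Module.End F[X] M) ≤ Module.finrank F M := by
    refine le_trans ?_ (h.trans hM.symm).le
    exact LinearMap.finrank_le_finrank_of_injective (f := Ψ₀.codRestrict _ hmem)
      (fun a b hab => hΨ (congrArg Subtype.val hab))
  have := finrank_le_of_end ht hle (minpoly F X) (minpoly.ne_zero (Matrix.isIntegral X)) (fun m => by
    apply (Module.AEval'.of φ).symm.injective
    rw [map_zero]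
    have : aeval φ (minpoly F X) = 0 := by
      rw [← map_zero Matrix.toLinAlgEquiv', ← minpoly.aeval F X]
      exact aeval_algHom_apply (Matrix.toLinAlgEquiv' : _ ≃ₐ[F] _).toAlgHom X _
    exact LinearMap.congr_fun this _)
  rwa [hM] at this

lemma finrank_of_cyclic {F : Type*} [Field F] {n : ℕ} (X : Matrix (Fin n) (Fin n) F)
    (v : Fin n → F) (hl : LinearIndependent F (fun i : Fin n => Matrix.vecMul v (X ^ (i : ℕ))))
    (hs : Submodule.span F (Set.range fun i : Fin n => Matrix.vecMul v (X ^ (i : ℕ))) = ⊤) :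
    Module.finrank F (Subalgebra.centralizer F ({X} : Set (Matrix (Fin n) (Fin n) F))) = n := by
  let E : Subalgebra.centralizer F ({X} : Set (Matrix (Fin n) (Fin n) F)) →ₗ[F] (Fin n → F) :=
    { toFun := fun Y => Matrix.vecMul v Y.1
      map_add' := fun a b => Matrix.vecMul_add _ _ _
      map_smul' := fun a b => Matrix.vecMul_smul _ _ _ }
  have hE : Function.Injective E := by
    rw [injective_iff_map_eq_zero]
    rintro ⟨Y, hY⟩ h0
    have h0 : Matrix.vecMul v Y = 0 := h0
    rw [Subalgebra.mem_centralizer_iff] at hY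
    have hc : Commute X Y := hY X rfl
    have : Matrix.vecMulLinear Y = 0 := by
      apply LinearMap.ext_on_range hs
      intro i
      rw [Matrix.vecMulLinear_apply, Matrix.vecMul_vecMul, (hc.pow_left i).eq,
        ← Matrix.vecMul_vecMul, h0]
      simp
    ext1
    apply Matrix.ext_of_single_vecMul
    intro i
    rw [← Matrix.vecMulLinear_apply, this]
    simp
  apply le_antisymm
  · simpa using LinearMap.finrank_le_finrank_of_injective hE
  · let w : Fin n → Subalgebra.centralizer F ({X} : Set (Matrix (Fin n) (Fin n) F)) :=
      fun i => ⟨X ^ (i : ℕ), by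
        rw [Subalgebra.mem_centralizer_iff]; rintro _ rfl; exact (Commute.self_pow _ _).eq⟩
    have hw : LinearIndependent F w := LinearIndependent.of_comp E hl
    simpa using hw.fintype_card_le_finrank

/-- For an `n × n` matrix `X` over a field `F` (with `n ≥ 1`), the following are
equivalent:
(i) there is a row vector `v` such that `v, vX, …, vX^{n−1}` form a basis of `Fⁿ`;
(ii) the centralizer `{Y : XY = YX}` of `X` in `M_n(F)` has `F`-dimension `n`;
(iii) the minimal polynomial of `X` equals its characteristic polynomial. -/
theorem regular_matrix_tfae {F : Type*} [Field F] {n : ℕ} (hn : 1 ≤ n)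
    (X : Matrix (Fin n) (Fin n) F) :
    [ (∃ v : Fin n → F,
        LinearIndependent F (fun i : Fin n => Matrix.vecMul v (X ^ (i : ℕ))) ∧
        Submodule.span F (Set.range fun i : Fin n => Matrix.vecMul v (X ^ (i : ℕ))) = ⊤),
      Module.finrank F (Subalgebra.centralizer F ({X} : Set (Matrix (Fin n) (Fin n) F))) = n,
      minpoly F X = X.charpoly ].TFAE := by
  have key : n ≤ (minpoly F X).natDegree → minpoly F X = X.charpoly := fun h =>
    (Polynomial.eq_of_monic_of_dvd_of_natDegree_le (minpoly.monic (Matrix.isIntegral X))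
      X.charpoly_monic X.minpoly_dvd_charpoly
      (by rw [Matrix.charpoly_natDegree_eq_dim]; simpa using h)).symm
  tfae_have 1 → 2 := fun ⟨v, hl, hs⟩ => finrank_of_cyclic X v hl hs
  tfae_have 2 → 3 := fun h => key (natDegree_of_finrank X h)
  tfae_have 3 → 1 := fun h => by
    obtain ⟨v, hv⟩ := cyclic_of_minpoly X h
    exact ⟨v, hv, hv.span_eq_top_of_card_eq_finrank' (by simp)⟩
  tfae_finish
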